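/- Fix α ∈ ℝ, β > 0 and σ > 0. (i) If there exists θ ∈ S(α, β, μ, σ) with θ > μ and μ′ < μ, then there exists θ′ ∈ S(α, β, μ′, σ) with θ′ > μ′. (ii) If there exists θ ∈ S(α, β, μ, σ) with θ < μ and μ′ > μ, then there exists θ′ ∈ S(α, β, μ′, σ) with θ′ < μ′. In other words, the set of interim beliefs μ for which a high-protest equilibrium (a solution above μ) exists is downward closed, and the set for which a low-protest equilibrium (a solution below μ) exists is upward closed. -/

import Mathlib

open Real MeasureTheory

/-- The standard normal cumulative distribution function
`Φ(z) = (1/√(2π)) ∫_{−∞}^{z} exp(−t²/2) dt`. -/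
noncomputable def stdNormalCDF (z : ℝ) : ℝ :=
  (Real.sqrt (2 * Real.pi))⁻¹ * ∫ t in Set.Iic z, Real.exp (-t ^ 2 / 2)

/-- The equilibrium solution set `S(α, β, μ, σ) = {θ : α + β·θ = Φ((θ − μ)/σ)}`. -/
def S (α β μ σ : ℝ) : Set ℝ :=
  {θ : ℝ | α + β * θ = stdNormalCDF ((θ - μ) / σ)}

theorem integrable_exp_neg_sq_div_two :
    Integrable fun t : ℝ => Real.exp (-t ^ 2 / 2) := by
  have h := integrable_exp_neg_mul_sq (b := 1 / 2) (by norm_num)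
  refine h.congr (Filter.Eventually.of_forall fun t => ?_)
  dsimp only
  congr 1
  ring

theorem continuous_stdNormalCDF : Continuous stdNormalCDF := by
  have hint := integrable_exp_neg_sq_div_two
  have h : stdNormalCDF = fun z => (Real.sqrt (2 * Real.pi))⁻¹ *
      ((∫ t in Set.Iic (0 : ℝ), Real.exp (-t ^ 2 / 2)) +
        ∫ t in (0 : ℝ)..z, Real.exp (-t ^ 2 / 2)) := by
    funext z
    rw [stdNormalCDF, ← intervalIntegral.integral_Iic_sub_Iic hint.integrableOn hint.integrableOn]
    ring
  rw [h]
  exact continuous_const.mul (continuous_const.add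
    (intervalIntegral.continuous_primitive (fun _ _ => hint.intervalIntegrable) 0))

theorem stdNormalCDF_nonneg (z : ℝ) : 0 ≤ stdNormalCDF z :=
  mul_nonneg (by positivity) (integral_nonneg fun _ => (Real.exp_pos _).le)

theorem stdNormalCDF_le_integral (z : ℝ) :
    stdNormalCDF z ≤ (Real.sqrt (2 * Real.pi))⁻¹ * ∫ t : ℝ, Real.exp (-t ^ 2 / 2) :=
  mul_le_mul_of_nonneg_left
    (setIntegral_le_integral integrable_exp_neg_sq_div_two
      (Filter.Eventually.of_forall fun _ => (Real.exp_pos _).le))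
    (by positivity)

/-- Proposition 3(i)–(ii): the set of interim beliefs `μ` for which a
high-protest equilibrium (a solution `θ > μ`) exists is downward closed, and
the set of `μ` for which a low-protest equilibrium (a solution `θ < μ`) exists
is upward closed. -/
theorem stmt15 (α β σ : ℝ) (hβ : 0 < β) (hσ : 0 < σ) :
    (∀ μ μ' : ℝ, (∃ θ ∈ S α β μ σ, θ > μ) → μ' < μ → ∃ θ' ∈ S α β μ' σ, θ' > μ') ∧
    (∀ μ μ' : ℝ, (∃ θ ∈ S α β μ σ, θ < μ) → μ' > μ → ∃ θ' ∈ S α β μ' σ, θ' < μ') := by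
  have hcont (μ' : ℝ) :
      Continuous fun θ : ℝ => α + β * θ - stdNormalCDF ((θ - μ') / σ) :=
    (by fun_prop : Continuous fun θ : ℝ => α + β * θ).sub
      (continuous_stdNormalCDF.comp (by fun_prop))
  have hshift (θ μ μ' : ℝ) : (θ + μ' - μ - μ') / σ = (θ - μ) / σ := by ring
  constructor
  · rintro μ μ' ⟨θ, hθ, hgt⟩ hlt
    change α + β * θ = stdNormalCDF ((θ - μ) / σ) at hθ
    obtain ⟨C, hC⟩ : ∃ C, ∀ z, stdNormalCDF z ≤ C := ⟨_, stdNormalCDF_le_integral⟩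
    set b := max (θ + μ' - μ) ((C - α) / β)
    have hb : C - α ≤ b * β := (div_le_iff₀ hβ).1 (le_max_right _ _)
    obtain ⟨x, hx, hx0⟩ := intermediate_value_Icc (le_max_left (θ + μ' - μ) ((C - α) / β))
      (hcont μ').continuousOn (show (0 : ℝ) ∈ Set.Icc _ _ from
        ⟨by rw [hshift, ← hθ]; nlinarith, by linarith [hC ((b - μ') / σ)]⟩)
    exact ⟨x, sub_eq_zero.1 hx0, by linarith [hx.1]⟩
  · rintro μ μ' ⟨θ, hθ, hlt⟩ hgt
    change α + β * θ = stdNormalCDF ((θ - μ) / σ) at hθ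
    set a := min (θ + μ' - μ) (-α / β)
    have ha : a * β ≤ -α := (le_div_iff₀ hβ).1 (min_le_right _ _)
    obtain ⟨x, hx, hx0⟩ := intermediate_value_Icc (min_le_left (θ + μ' - μ) (-α / β))
      (hcont μ').continuousOn (show (0 : ℝ) ∈ Set.Icc _ _ from
        ⟨by linarith [stdNormalCDF_nonneg ((a - μ') / σ)], by rw [hshift, ← hθ]; nlinarith⟩)
    exact ⟨x, sub_eq_zero.1 hx0, by linarith [hx.2]⟩
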